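/- Safety preservation: let S = S1 ⋈_{H,K} S2 be the system composed from communicating systems S1 and S2 with compatible CFSMs for the roles H and K. If S1 and S2 are both safe, then S is safe. -/

import Mathlib

/- Common formalization of Communicating Finite State Machines (CFSMs),
communicating systems, gateways and their composition, following
"Global Types with Internal Delegation" / GTIR paper definitions. -/

namespace GTIR

/-- Polarity of an action: `!` (send) or `?` (receive). -/
inductive Pol : Type
  | bang
  | query
deriving DecidableEq

/-- Dual polarity: swap `!` and `?`. -/
def Pol.dual : Pol → Pol
  | .bang => .query
  | .query => .bang

/-- Actions over roles `R` and messages `A`: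
`snd s r a` is `sr!a` (s sends `a` to r), `rcv s r a` is `sr?a`
(r receives/consumes `a` sent by s). -/
inductive Act (R A : Type) : Type
  | snd : R → R → A → Act R A
  | rcv : R → R → A → Act R A

/-- The action is a send action. -/
def Act.isSend {R A : Type} : Act R A → Prop
  | .snd _ _ _ => True
  | .rcv _ _ _ => False

/-- The action is a receive action. -/
def Act.isRecv {R A : Type} : Act R A → Prop
  | .snd _ _ _ => False
  | .rcv _ _ _ => True

/-- Erase the channel name of an action: `pq!a ↦ !a`, `pq?a ↦ ?a`. -/
def Act.noC {R A : Type} : Act R A → Pol × A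
  | .snd _ _ a => (.bang, a)
  | .rcv _ _ a => (.query, a)

/-- The dual of a word over `{!,?} × A`: swap `!` and `?` pointwise. -/
def dualWord {A : Type} (w : List (Pol × A)) : List (Pol × A) :=
  w.map fun x => (x.1.dual, x.2)

/-- Universal state type: base states from `B`, plus arbitrarily nested fresh
"hat" states (one for each transition) used by the gateway construction. -/
inductive St (R A B : Type) : Type
  | base : B → St R A B
  | hat : St R A B → Act R A → St R A B → St R A B

/-- A communicating finite state machine over roles `R` and messages `A`,
with states taken from `St R A B`: an initial state together with a
transition relation. -/
structure CFSM (R A B : Type) where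
  init : St R A B
  delta : Set (St R A B × Act R A × St R A B)

namespace CFSM

variable {R A B : Type}

/-- A state is final if it has no outgoing transition. -/
def Final (M : CFSM R A B) (q : St R A B) : Prop :=
  ∀ l q', (q, l, q') ∉ M.delta

/-- A sending state: non-final, and all outgoing transitions are sends. -/
def Sending (M : CFSM R A B) (q : St R A B) : Prop :=
  (∃ l q', (q, l, q') ∈ M.delta) ∧ ∀ l q', (q, l, q') ∈ M.delta → l.isSend

/-- A receiving state: non-final, and all outgoing transitions are receives. -/
def Receiving (M : CFSM R A B) (q : St R A B) : Prop :=
  (∃ l q', (q, l, q') ∈ M.delta) ∧ ∀ l q', (q, l, q') ∈ M.delta → l.isRecv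

/-- A mixed state: it has both an outgoing send and an outgoing receive. -/
def Mixed (M : CFSM R A B) (q : St R A B) : Prop :=
  (∃ l q', (q, l, q') ∈ M.delta ∧ l.isSend) ∧
  (∃ l q', (q, l, q') ∈ M.delta ∧ l.isRecv)

/-- `M` has no mixed states. -/
def NoMixed (M : CFSM R A B) : Prop := ∀ q, ¬ M.Mixed q

/-- `?`-determinism: two receives of the same message from the same state
(possibly on different channels) have the same target. -/
def QDet (M : CFSM R A B) : Prop :=
  ∀ q a s r s' r' q' q'', (q, Act.rcv s r a, q') ∈ M.delta →
    (q, Act.rcv s' r' a, q'') ∈ M.delta → q' = q''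

/-- `!`-determinism: two sends of the same message from the same state
(possibly on different channels) have the same target. -/
def BDet (M : CFSM R A B) : Prop :=
  ∀ q a s r s' r' q' q'', (q, Act.snd s r a, q') ∈ M.delta →
    (q, Act.snd s' r' a, q'') ∈ M.delta → q' = q''

/-- `?!`-determinism. -/
def IODet (M : CFSM R A B) : Prop := M.QDet ∧ M.BDet

/-- Accepting runs from a given state (every state is accepting). -/
inductive Accepts (M : CFSM R A B) : St R A B → List (Act R A) → Prop
  | nil (q : St R A B) : Accepts M q []
  | cons {q : St R A B} {l : Act R A} {q' : St R A B} {φ : List (Act R A)} :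
      (q, l, q') ∈ M.delta → Accepts M q' φ → Accepts M q (l :: φ)

/-- The language of `M` over `Act`. -/
def lang (M : CFSM R A B) : Set (List (Act R A)) := {φ | M.Accepts M.init φ}

/-- The language of `M` with channel names erased. -/
def langNoC (M : CFSM R A B) : Set (List (Pol × A)) :=
  (fun φ => φ.map Act.noC) '' M.lang

/-- Compatibility `M ↔ M'`: the channel-erased language of `M` is the set of
duals of the channel-erased language of `M'`; moreover neither machine has a
mixed state and both are `?!`-deterministic. -/
def Compat (M M' : CFSM R A B) : Prop :=
  M.langNoC = dualWord '' M'.langNoC ∧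
  M.NoMixed ∧ M'.NoMixed ∧ M.IODet ∧ M'.IODet

/-- The machine of role `p` over the role set `P`: every transition label is
an action of `p` (a send `pr!a` or a receive `rp?a`) with partner `r ∈ P`. -/
def ActsFor (M : CFSM R A B) (p : R) (P : Set R) : Prop :=
  ∀ q l q', (q, l, q') ∈ M.delta →
    ∃ r a, r ∈ P ∧ r ≠ p ∧ (l = Act.snd p r a ∨ l = Act.rcv r p a)

/-- All states occurring in `M` are base states; this guarantees that the
intermediate "hat" states of the gateway construction are fresh for `M`. -/
def HatFree (M : CFSM R A B) : Prop :=
  (∃ b, M.init = St.base b) ∧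
  ∀ q l q', (q, l, q') ∈ M.delta →
    (∃ b, q = St.base b) ∧ (∃ b, q' = St.base b)

/-- The set `Q̂` of fresh intermediate gateway states of `M`
(one for each transition of `M`). -/
def hatStates (M : CFSM R A B) : Set (St R A B) :=
  {x | ∃ q l q', (q, l, q') ∈ M.delta ∧ x = St.hat q l q'}

/-- The gateway `gw(M_H, K)` of the machine `M` of role `H` towards role `K`:
each transition `t = (q, Hs!a, q')` of `M` is replaced by
`(q, KH?a, q̂_t)` and `(q̂_t, Hs!a, q')`, and each transition
`t = (q, sH?a, q')` of `M` is replaced by `(q, sH?a, q̂_t)` and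
`(q̂_t, HK!a, q')`. -/
def gw (M : CFSM R A B) (H K : R) : CFSM R A B where
  init := M.init
  delta :=
    {x | ∃ q s a q', (q, Act.snd H s a, q') ∈ M.delta ∧
      (x = (q, Act.rcv K H a, St.hat q (Act.snd H s a) q') ∨
       x = (St.hat q (Act.snd H s a) q', Act.snd H s a, q'))} ∪
    {x | ∃ q s a q', (q, Act.rcv s H a, q') ∈ M.delta ∧
      (x = (q, Act.rcv s H a, St.hat q (Act.rcv s H a) q') ∨
       x = (St.hat q (Act.rcv s H a) q', Act.snd H K a, q'))}

end CFSM

/-- A communicating system: a set of roles together with a CFSM for each role. -/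
structure CS (R A B : Type) where
  roles : Set R
  mach : R → CFSM R A B

namespace CS

variable {R A B : Type}

/-- Well-formedness: the machine of each role `p` of the system only carries
actions of `p` with partners among the system's roles. -/
def WF (S : CS R A B) : Prop :=
  ∀ p ∈ S.roles, (S.mach p).ActsFor p S.roles

/-- Each machine of the system has a finite transition relation
(hence finitely many relevant states). -/
def FiniteSys (S : CS R A B) : Prop :=
  ∀ p ∈ S.roles, (S.mach p).delta.Finite

open scoped Classical in
/-- Composition `S1 ⋈_{H,K} S2`: the union of the two systems, where the
machines of the interface roles `H` and `K` are replaced by the gateways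
`gw(M¹_H, K)` and `gw(M²_K, H)`. -/
noncomputable def compose (S1 S2 : CS R A B) (H K : R) : CS R A B where
  roles := S1.roles ∪ S2.roles
  mach := fun p =>
    if p = H then (S1.mach H).gw H K
    else if p = K then (S2.mach K).gw K H
    else if p ∈ S1.roles then S1.mach p
    else S2.mach p

end CS

/-- A configuration: a local state for every role and a buffer (word over the
messages) for every ordered channel. -/
structure Config (R A B : Type) where
  st : R → St R A B
  buf : R → R → List A

/-- The initial configuration(s) of a system: every machine of the system is
in its initial state and all the system's buffers are empty. -/
def InitConf {R A B : Type} (S : CS R A B) (c : Config R A B) : Prop :=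
  (∀ p ∈ S.roles, c.st p = (S.mach p).init) ∧
  (∀ p ∈ S.roles, ∀ q ∈ S.roles, c.buf p q = [])

/-- One asynchronous step of system `S`, labelled by an action:
a send `sr!a` appends `a` to the buffer of channel `sr`, a receive `sr?a`
removes `a` from the front of the buffer of channel `sr`; everything else is
unchanged. -/
def Step {R A B : Type} (S : CS R A B) (c : Config R A B) :
    Act R A → Config R A B → Prop
  | .snd s r a, c' =>
      s ∈ S.roles ∧ (c.st s, Act.snd s r a, c'.st s) ∈ (S.mach s).delta ∧
      (∀ p, p ≠ s → c'.st p = c.st p) ∧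
      c'.buf s r = c.buf s r ++ [a] ∧
      (∀ p q, ¬(p = s ∧ q = r) → c'.buf p q = c.buf p q)
  | .rcv s r a, c' =>
      r ∈ S.roles ∧ (c.st r, Act.rcv s r a, c'.st r) ∈ (S.mach r).delta ∧
      (∀ p, p ≠ r → c'.st p = c.st p) ∧
      c.buf s r = a :: c'.buf s r ∧
      (∀ p q, ¬(p = s ∧ q = r) → c'.buf p q = c.buf p q)

/-- `RS(S)`: the configurations reachable from the initial configuration. -/
def Reach {R A B : Type} (S : CS R A B) (c : Config R A B) : Prop :=
  ∃ c₀, InitConf S c₀ ∧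
    Relation.ReflTransGen (fun x y => ∃ l, Step S x l y) c₀ c

/-- Deadlock configuration: all the system's buffers are empty and every
machine is in a receiving state. -/
def DeadlockConf {R A B : Type} (S : CS R A B) (c : Config R A B) : Prop :=
  (∀ p ∈ S.roles, ∀ q ∈ S.roles, c.buf p q = []) ∧
  ∀ p ∈ S.roles, (S.mach p).Receiving (c.st p)

/-- A system is deadlock-free if no reachable configuration is a deadlock. -/
def DeadlockFree {R A B : Type} (S : CS R A B) : Prop :=
  ∀ c, Reach S c → ¬ DeadlockConf S c

/-- Orphan-message configuration: every machine is in a final state but some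
buffer of the system is non-empty. -/
def OrphanConf {R A B : Type} (S : CS R A B) (c : Config R A B) : Prop :=
  (∀ p ∈ S.roles, (S.mach p).Final (c.st p)) ∧
  ∃ p ∈ S.roles, ∃ q ∈ S.roles, c.buf p q ≠ []

/-- Unspecified reception configuration: some machine is in a receiving state
but each of its expected input buffers is non-empty and starts with a message
it cannot receive. -/
def UnspecConf {R A B : Type} (S : CS R A B) (c : Config R A B) : Prop :=
  ∃ r ∈ S.roles, (S.mach r).Receiving (c.st r) ∧
    ∀ s a q', (c.st r, Act.rcv s r a, q') ∈ (S.mach r).delta →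
      c.buf s r ≠ [] ∧ ∀ w, c.buf s r ≠ a :: w

/-- A system is safe if no reachable configuration is a deadlock,
an orphan-message, or an unspecified reception configuration. -/
def Safe {R A B : Type} (S : CS R A B) : Prop :=
  ∀ c, Reach S c →
    ¬ DeadlockConf S c ∧ ¬ OrphanConf S c ∧ ¬ UnspecConf S c

end GTIR

open GTIR

namespace GTIR
section Helpers
variable {R A B : Type}

theorem noC_det {M : CFSM R A B} (hd : M.IODet) {q l l' q1 q2}
    (h1 : (q, l, q1) ∈ M.delta) (h2 : (q, l', q2) ∈ M.delta) (h : l.noC = l'.noC) : q1 = q2 := by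
  cases l <;> cases l' <;> simp [Act.noC] at h
  · subst h; exact hd.2 _ _ _ _ _ _ _ _ h1 h2
  · subst h; exact hd.1 _ _ _ _ _ _ _ _ h1 h2

def AccC (M : CFSM R A B) (q : St R A B) (w : List (Pol × A)) : Prop :=
  ∃ φ, M.Accepts q φ ∧ φ.map Act.noC = w

def DualSt (M M' : CFSM R A B) (q q' : St R A B) : Prop :=
  ∀ w, AccC M q w ↔ AccC M' q' (dualWord w)

theorem dualWord_dualWord (w : List (Pol × A)) : dualWord (dualWord w) = w := by
  induction w with
  | nil => rfl
  | cons x w ih =>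
    obtain ⟨p, a⟩ := x
    simp only [dualWord, List.map_cons] at ih ⊢
    rw [ih]; cases p <;> rfl

theorem DualSt.symm {M M' : CFSM R A B} {q q'} (h : DualSt M M' q q') : DualSt M' M q' q := by
  intro w
  rw [h (dualWord w), dualWord_dualWord]

theorem accC_cons {M : CFSM R A B} (hd : M.IODet) {q l q1} (h : (q, l, q1) ∈ M.delta) (w) :
    AccC M q (l.noC :: w) ↔ AccC M q1 w := by
  constructor
  · rintro ⟨φ, hφ, e⟩
    cases hφ with
    | nil => simp at e
    | cons h1 h2 =>
      simp only [List.map_cons, List.cons.injEq] at e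
      have := noC_det hd h h1 e.1.symm
      subst this
      exact ⟨_, h2, e.2⟩
  · rintro ⟨φ, hφ, e⟩
    exact ⟨l :: φ, .cons h hφ, by simp [e]⟩

theorem DualSt.step {M M' : CFSM R A B} (hd : M.IODet) (hd' : M'.IODet) {q q' l q1}
    (h : DualSt M M' q q') (ht : (q, l, q1) ∈ M.delta) :
    ∃ l' q1', (q', l', q1') ∈ M'.delta ∧ l'.noC = (l.noC.1.dual, l.noC.2) ∧
      DualSt M M' q1 q1' := by
  have h1 : AccC M q [l.noC] := (accC_cons hd ht []).2 ⟨[], .nil _, rfl⟩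
  obtain ⟨φ, hφ, e⟩ := (h _).1 h1
  cases hφ with
  | nil => simp [dualWord] at e
  | @cons _ l' q1' _ h1 h2 =>
    simp only [List.map_cons, dualWord, List.cons.injEq] at e
    refine ⟨l', q1', h1, e.1, fun w => ?_⟩
    rw [← accC_cons hd ht, h, ← accC_cons hd' h1, e.1]
    rfl

/-- dual of a receive is a send -/
theorem DualSt.rcv {M M' : CFSM R A B} (hd : M.IODet) (hd' : M'.IODet) {q q' s r a q1}
    (h : DualSt M M' q q') (ht : (q, Act.rcv s r a, q1) ∈ M.delta) :
    ∃ s' r' q1', (q', Act.snd s' r' a, q1') ∈ M'.delta ∧ DualSt M M' q1 q1' := by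
  obtain ⟨l', q1', h1, h2, h3⟩ := h.step hd hd' ht
  cases l' <;> simp [Act.noC, Pol.dual] at h2
  subst h2; exact ⟨_, _, _, h1, h3⟩

theorem DualSt.snd {M M' : CFSM R A B} (hd : M.IODet) (hd' : M'.IODet) {q q' s r a q1}
    (h : DualSt M M' q q') (ht : (q, Act.snd s r a, q1) ∈ M.delta) :
    ∃ s' r' q1', (q', Act.rcv s' r' a, q1') ∈ M'.delta ∧ DualSt M M' q1 q1' := by
  obtain ⟨l', q1', h1, h2, h3⟩ := h.step hd hd' ht
  cases l' <;> simp [Act.noC, Pol.dual] at h2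
  subst h2; exact ⟨_, _, _, h1, h3⟩

theorem not_mixed {M : CFSM R A B} (h : M.NoMixed) {q s r a q1 s' r' a' q1'}
    (h1 : (q, Act.snd s r a, q1) ∈ M.delta) (h2 : (q, Act.rcv s' r' a', q1') ∈ M.delta) : False :=
  h q ⟨⟨_, _, h1, trivial⟩, ⟨_, _, h2, trivial⟩⟩

def RP (M : CFSM R A B) : St R A B → List A → St R A B → Prop
  | q, [], q' => q = q'
  | q, a :: w, q' => ∃ s r q1, (q, Act.rcv s r a, q1) ∈ M.delta ∧ RP M q1 w q'

theorem RP.snoc {M : CFSM R A B} {w : List A} {q q' s r a q''} (h : RP M q w q')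
    (ht : (q', Act.rcv s r a, q'') ∈ M.delta) : RP M q (w ++ [a]) q'' := by
  induction w generalizing q with
  | nil => cases h; exact ⟨_, _, _, ht, rfl⟩
  | cons b w ih =>
    obtain ⟨s, r, q1, h1, h2⟩ := h
    exact ⟨s, r, q1, h1, ih h2⟩

/-- interface view of a gateway state -/
def ifc : St R A B → St R A B
  | .base b => .base b
  | .hat _ (.snd _ _ _) q' => q'
  | .hat q (.rcv _ _ _) _ => q

/-- internal view of a gateway state -/
def pj : St R A B → St R A B
  | .base b => .base b
  | .hat q (.snd _ _ _) _ => q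
  | .hat _ (.rcv _ _ _) q' => q'

theorem hf_src {M : CFSM R A B} (h : M.HatFree) {q l q'} (ht : (q, l, q') ∈ M.delta) :
    ifc q = q ∧ pj q = q ∧ ∀ x m y, q ≠ St.hat x m y := by
  obtain ⟨⟨b, rfl⟩, _⟩ := h.2 _ _ _ ht
  exact ⟨rfl, rfl, by simp⟩

theorem hf_tgt {M : CFSM R A B} (h : M.HatFree) {q l q'} (ht : (q, l, q') ∈ M.delta) :
    ifc q' = q' ∧ pj q' = q' ∧ ∃ b, q' = St.base b := by
  obtain ⟨_, ⟨b, rfl⟩⟩ := h.2 _ _ _ ht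
  exact ⟨rfl, rfl, _, rfl⟩

def Half (M M' : CFSM R A B) (q q' : St R A B) (out inn : List A) : Prop :=
  inn = [] ∧ ∃ q0, DualSt M M' q0 q' ∧ RP M q0 out q

def Link (M M' : CFSM R A B) (q q' : St R A B) (out inn : List A) : Prop :=
  Half M M' q q' out inn ∨ Half M' M q' q inn out

theorem Link.symm {M M' : CFSM R A B} {q q' : St R A B} {out inn : List A}
    (h : Link M M' q q' out inn) : Link M' M q' q inn out := Or.symm h

/-- head of the incoming buffer can be emitted -/
theorem Link.head {M M' : CFSM R A B} (hd : M.IODet) (hd' : M'.IODet) {q q' : St R A B}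
    {out inn : List A} {a} (h : Link M M' q q' out (a :: inn)) :
    ∃ s r q1, (q, Act.snd s r a, q1) ∈ M.delta ∧ Link M M' q1 q' out inn := by
  rcases h with ⟨h, _⟩ | ⟨ho, q0, h1, s, r, q2, h2, h3⟩
  · simp at h
  · obtain ⟨s', r', q1', h4, h5⟩ := h1.rcv hd' hd h2
    exact ⟨s', r', q1', h4, Or.inr ⟨ho, _, h5, h3⟩⟩

theorem Link.send {M M' : CFSM R A B} (hd : M.IODet) (hd' : M'.IODet) (hm' : M'.NoMixed)
    {q q' : St R A B} {out inn : List A} {s r a q1} (h : Link M M' q q' out inn)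
    (ht : (q, Act.rcv s r a, q1) ∈ M.delta) : Link M M' q1 q' (out ++ [a]) inn := by
  rcases h with ⟨h, q0, h1, h2⟩ | ⟨ho, q0, h1, h2⟩
  · exact Or.inl ⟨h, q0, h1, h2.snoc ht⟩
  · subst ho
    obtain ⟨s', r', q1', h4, h5⟩ := h1.symm.rcv hd hd' ht
    cases inn with
    | cons b w =>
      obtain ⟨_, _, _, h6, _⟩ := h2
      exact (not_mixed hm' h4 h6).elim
    | nil =>
      cases h2
      exact Or.inl ⟨rfl, q, h1.symm, _, _, _, ht, rfl⟩

structure Ctx (S1 S2 : CS R A B) (H K : R) (S : CS R A B) : Prop where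
  hH : H ∈ S1.roles
  hK : K ∈ S2.roles
  disj : ∀ p, p ∈ S1.roles → p ∈ S2.roles → False
  roles : ∀ p, p ∈ S.roles ↔ p ∈ S1.roles ∨ p ∈ S2.roles
  mH : S.mach H = (S1.mach H).gw H K
  mK : S.mach K = (S2.mach K).gw K H
  m1 : ∀ p ∈ S1.roles, p ≠ H → S.mach p = S1.mach p
  m2 : ∀ p ∈ S2.roles, p ≠ K → S.mach p = S2.mach p
  wf1 : S1.WF
  wf2 : S2.WF
  hf1 : (S1.mach H).HatFree
  hf2 : (S2.mach K).HatFree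
  nm1 : (S1.mach H).NoMixed
  nm2 : (S2.mach K).NoMixed
  d1 : (S1.mach H).IODet
  d2 : (S2.mach K).IODet
  du : DualSt (S1.mach H) (S2.mach K) (S1.mach H).init (S2.mach K).init

theorem Ctx.symm {S1 S2 : CS R A B} {H K S} (h : Ctx S1 S2 H K S) : Ctx S2 S1 K H S :=
  ⟨h.hK, h.hH, fun p a b => h.disj p b a, fun p => (h.roles p).trans or_comm, h.mK, h.mH, h.m2,
    h.m1, h.wf2, h.wf1, h.hf2, h.hf1, h.nm2, h.nm1, h.d2, h.d1, h.du.symm⟩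

open scoped Classical in
noncomputable def proj (S : CS R A B) (H : R) (c : Config R A B) : Config R A B where
  st p := if p ∈ S.roles then (if p = H then pj (c.st p) else c.st p) else (S.mach H).init
  buf p q := if p ∈ S.roles ∧ q ∈ S.roles then c.buf p q else []

def VSt (M : CFSM R A B) (x : St R A B) : Prop :=
  (∃ b, x = St.base b) ∨ ∃ q l q', (q, l, q') ∈ M.delta ∧ x = St.hat q l q'

structure Inv (S1 S2 : CS R A B) (H K : R) (c : Config R A B) : Prop where
  r1 : Reach S1 (proj S1 H c)
  r2 : Reach S2 (proj S2 K c)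
  v1 : VSt (S1.mach H) (c.st H)
  v2 : VSt (S2.mach K) (c.st K)
  b1 : ∀ p ∈ S1.roles, ∀ q ∈ S2.roles, ¬(p = H ∧ q = K) → c.buf p q = []
  b2 : ∀ p ∈ S2.roles, ∀ q ∈ S1.roles, ¬(p = K ∧ q = H) → c.buf p q = []
  lk : Link (S1.mach H) (S2.mach K) (ifc (c.st H)) (ifc (c.st K)) (c.buf H K) (c.buf K H)

theorem Inv.symm {S1 S2 : CS R A B} {H K c} (h : Inv S1 S2 H K c) : Inv S2 S1 K H c :=
  ⟨h.r2, h.r1, h.v2, h.v1, h.b2, h.b1, h.lk.symm⟩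

theorem Reach.snoc {S : CS R A B} {c c' l} (h : Reach S c) (hs : Step S c l c') : Reach S c' := by
  obtain ⟨c0, h0, h1⟩ := h
  exact ⟨c0, h0, h1.tail ⟨l, hs⟩⟩

theorem proj_eq {S : CS R A B} {H : R} {c c' : Config R A B}
    (h1 : ∀ p ∈ S.roles, p ≠ H → c'.st p = c.st p)
    (h2 : pj (c'.st H) = pj (c.st H))
    (h3 : ∀ p ∈ S.roles, ∀ q ∈ S.roles, c'.buf p q = c.buf p q) : proj S H c' = proj S H c := by
  unfold proj
  congr 1
  · funext p
    by_cases hp : p ∈ S.roles <;> by_cases hq : p = H <;> grind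
  · funext p q
    grind

theorem gw_cases {M : CFSM R A B} {H K : R} {x l y} (h : (x, l, y) ∈ (M.gw H K).delta) :
    (∃ s a q', (x, Act.snd H s a, q') ∈ M.delta ∧ l = Act.rcv K H a ∧
      y = St.hat x (Act.snd H s a) q') ∨
    (∃ q s a, (q, Act.snd H s a, y) ∈ M.delta ∧ l = Act.snd H s a ∧
      x = St.hat q (Act.snd H s a) y) ∨
    (∃ s a q', (x, Act.rcv s H a, q') ∈ M.delta ∧ l = Act.rcv s H a ∧
      y = St.hat x (Act.rcv s H a) q') ∨
    (∃ q s a, (q, Act.rcv s H a, y) ∈ M.delta ∧ l = Act.snd H K a ∧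
      x = St.hat q (Act.rcv s H a) y) := by
  simp only [CFSM.gw, Set.mem_union, Set.mem_setOf_eq, Prod.mk.injEq] at h
  rcases h with ⟨q, s, a, q', h, ⟨rfl, rfl, rfl⟩ | ⟨rfl, rfl, rfl⟩⟩ |
    ⟨q, s, a, q', h, ⟨rfl, rfl, rfl⟩ | ⟨rfl, rfl, rfl⟩⟩
  · exact Or.inl ⟨_, _, _, h, rfl, rfl⟩
  · exact Or.inr (Or.inl ⟨_, _, _, h, rfl, rfl⟩)
  · exact Or.inr (Or.inr (Or.inl ⟨_, _, _, h, rfl, rfl⟩))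
  · exact Or.inr (Or.inr (Or.inr ⟨_, _, _, h, rfl, rfl⟩))

theorem wf_snd {S : CS R A B} (h : S.WF) {p} (hp : p ∈ S.roles) {q s r a q'}
    (ht : (q, Act.snd s r a, q') ∈ (S.mach p).delta) : s = p ∧ r ∈ S.roles ∧ r ≠ p := by
  obtain ⟨r', a', h1, h2, h3 | h3⟩ := h p hp _ _ _ ht
  · cases h3; exact ⟨rfl, h1, h2⟩
  · cases h3

theorem wf_rcv {S : CS R A B} (h : S.WF) {p} (hp : p ∈ S.roles) {q s r a q'}
    (ht : (q, Act.rcv s r a, q') ∈ (S.mach p).delta) : r = p ∧ s ∈ S.roles ∧ s ≠ p := by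
  obtain ⟨r', a', h1, h2, h3 | h3⟩ := h p hp _ _ _ ht
  · cases h3
  · cases h3; exact ⟨rfl, h1, h2⟩

def actor : Act R A → R
  | .snd s _ _ => s
  | .rcv _ r _ => r

/-- transfer of a send step to the projection -/
theorem proj_snd {S : CS R A B} {H : R} {c c' : Config R A B} {s r : R} {a : A}
    (hs : s ∈ S.roles) (hr : r ∈ S.roles)
    (ht : ((proj S H c).st s, Act.snd s r a, (proj S H c').st s) ∈ (S.mach s).delta)
    (h1 : ∀ p, p ≠ s → c'.st p = c.st p) (h2 : c'.buf s r = c.buf s r ++ [a])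
    (h3 : ∀ p q, ¬(p = s ∧ q = r) → c'.buf p q = c.buf p q) :
    Step S (proj S H c) (.snd s r a) (proj S H c') := by
  refine ⟨hs, ht, ?_, ?_, ?_⟩
  · intro p hp; simp only [proj, h1 p hp]
  · simp [proj, hs, hr, h2]
  · intro p q hpq; simp only [proj, h3 p q hpq]

theorem proj_rcv {S : CS R A B} {H : R} {c c' : Config R A B} {s r : R} {a : A}
    (hs : s ∈ S.roles) (hr : r ∈ S.roles)
    (ht : ((proj S H c).st r, Act.rcv s r a, (proj S H c').st r) ∈ (S.mach r).delta)
    (h1 : ∀ p, p ≠ r → c'.st p = c.st p) (h2 : c.buf s r = a :: c'.buf s r)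
    (h3 : ∀ p q, ¬(p = s ∧ q = r) → c'.buf p q = c.buf p q) :
    Step S (proj S H c) (.rcv s r a) (proj S H c') := by
  refine ⟨hr, ht, ?_, ?_, ?_⟩
  · intro p hp; simp only [proj, h1 p hp]
  · simp [proj, hs, hr, h2]
  · intro p q hpq; simp only [proj, h3 p q hpq]

theorem proj_st_ne {S : CS R A B} {H p : R} {c : Config R A B} (hp : p ∈ S.roles) (h : p ≠ H) :
    (proj S H c).st p = c.st p := by simp [proj, hp, h]

theorem proj_st_H {S : CS R A B} {H : R} {c : Config R A B} (hp : H ∈ S.roles) :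
    (proj S H c).st H = pj (c.st H) := by simp [proj, hp]

theorem proj_buf {S : CS R A B} {H p q : R} {c : Config R A B} (hp : p ∈ S.roles)
    (hq : q ∈ S.roles) : (proj S H c).buf p q = c.buf p q := by simp [proj, hp, hq]

theorem Inv.stepL {S1 S2 S : CS R A B} {H K : R} {c c' : Config R A B} {l : Act R A}
    (C : Ctx S1 S2 H K S) (I : Inv S1 S2 H K c) (hl : actor l ∈ S1.roles)
    (hs : Step S c l c') : Inv S1 S2 H K c' := by
  have hHK : H ≠ K := fun e => C.disj _ C.hH (e ▸ C.hK)
  have hH2 : H ∉ S2.roles := fun h => C.disj _ C.hH h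
  have hK1 : K ∉ S1.roles := fun h => C.disj _ h C.hK
  by_cases hp : actor l = H
  · cases l with
    | snd s r a =>
      obtain ⟨_, ht, h1, h2, h3⟩ := hs
      simp only [actor] at hp hl
      subst hp
      rw [C.mH] at ht
      have hst2 : ∀ p ∈ S2.roles, c'.st p = c.st p := fun p hp => h1 p (by grind)
      have hb2 : ∀ p ∈ S2.roles, ∀ q, c'.buf p q = c.buf p q := fun p hp q => h3 p q (by grind)
      have hp2 : proj S2 K c' = proj S2 K c :=
        proj_eq (fun p hp _ => hst2 p hp) (by rw [hst2 K C.hK]) (fun p hp q _ => hb2 p hp q)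
      rcases gw_cases ht with ⟨_, _, _, _, e, _⟩ | ⟨q, s', a', hd, e, hx⟩ | ⟨_, _, _, _, e, _⟩ |
        ⟨q, s', a', hd, e, hx⟩
      · cases e
      · cases e
        obtain ⟨e1, e2, b, eb⟩ := hf_tgt C.hf1 hd
        obtain ⟨_, hr, hr'⟩ := wf_snd C.wf1 hl hd
        have hrK : r ≠ K := fun e => hK1 (e ▸ hr)
        refine ⟨I.r1.snoc (l := .snd s r a) (proj_snd hl hr ?_ h1 h2 h3), hp2 ▸ I.r2,
          Or.inl ⟨b, eb⟩, hst2 K C.hK ▸ I.v2, ?_, ?_, ?_⟩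
        · rw [proj_st_H hl, proj_st_H hl, e2, hx]; exact hd
        · intro p hp q hq hpq
          rw [h3 p q (by grind [C.disj])]; exact I.b1 p hp q hq hpq
        · intro p hp q hq hpq
          rw [hb2 p hp]; exact I.b2 p hp q hq hpq
        · have := I.lk
          rw [hx] at this
          rw [hst2 K C.hK, hb2 K C.hK, h3 s K (by grind), e1]
          exact this
      · cases e
      · cases e
        obtain ⟨e1, e2, b, eb⟩ := hf_tgt C.hf1 hd
        have hp1 : proj S1 s c' = proj S1 s c := by
          refine proj_eq (fun p _ hp => h1 p hp) (by rw [e2, hx]; rfl) (fun p hp q hq => h3 p q ?_)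
          rintro ⟨-, rfl⟩; exact hK1 hq
        refine ⟨hp1 ▸ I.r1, hp2 ▸ I.r2,
          Or.inl ⟨b, eb⟩, hst2 _ C.hK ▸ I.v2, ?_, ?_, ?_⟩
        · intro p hp q hq hpq
          rw [h3 p q hpq]; exact I.b1 p hp q hq hpq
        · intro p hp q hq hpq
          rw [hb2 p hp]; exact I.b2 p hp q hq hpq
        · have := I.lk
          rw [hx] at this
          rw [hst2 _ C.hK, hb2 _ C.hK, h2, e1]
          exact this.send C.d1 C.d2 C.nm2 hd
    | rcv s r a =>
      obtain ⟨_, ht, h1, h2, h3⟩ := hs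
      simp only [actor] at hp hl
      subst hp
      rw [C.mH] at ht
      have hst2 : ∀ p ∈ S2.roles, c'.st p = c.st p := fun p hp => h1 p (by grind)
      have hb2 : ∀ p, ∀ q ∈ S2.roles, c'.buf p q = c.buf p q := fun p q hp => h3 p q (by grind)
      have hp2 : proj S2 K c' = proj S2 K c :=
        proj_eq (fun p hp _ => hst2 p hp) (by rw [hst2 K C.hK]) (fun p _ q hp => hb2 p q hp)
      rcases gw_cases ht with ⟨s', a', q', hd, e, hx⟩ | ⟨_, _, _, _, e, _⟩ | ⟨s', a', q', hd, e, hx⟩ |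
        ⟨_, _, _, _, e, _⟩
      · cases e
        obtain ⟨e1, e2, _⟩ := hf_src C.hf1 hd
        have hp1 : proj S1 r c' = proj S1 r c := by
          refine proj_eq (fun p _ hp => h1 p hp) (by rw [e2, hx]; rfl) (fun p hp q hq => h3 p q ?_)
          rintro ⟨rfl, -⟩; exact hK1 hp
        refine ⟨hp1 ▸ I.r1, hp2 ▸ I.r2,
          Or.inr ⟨_, _, _, hd, hx⟩, hst2 _ C.hK ▸ I.v2, ?_, ?_, ?_⟩
        · intro p hp q hq hpq
          rw [hb2 p q hq]; exact I.b1 p hp q hq hpq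
        · intro p hp q hq hpq
          rw [h3 p q hpq]; exact I.b2 p hp q hq hpq
        · have := I.lk
          rw [h2] at this
          obtain ⟨_, _, q1, h4, h5⟩ := this.head C.d1 C.d2
          rw [e1] at h4
          have : q1 = q' := C.d1.2 _ _ _ _ _ _ _ _ h4 hd
          subst this
          rw [hst2 _ C.hK, hb2 _ _ C.hK, hx]
          exact h5
      · cases e
      · cases e
        obtain ⟨e1, e2, _⟩ := hf_src C.hf1 hd
        obtain ⟨_, hr, hr'⟩ := wf_rcv C.wf1 hl hd
        have hrK : s ≠ K := fun e => hK1 (e ▸ hr)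
        refine ⟨I.r1.snoc (l := .rcv s r a) (proj_rcv hr hl ?_ h1 h2 h3), hp2 ▸ I.r2,
          Or.inr ⟨_, _, _, hd, hx⟩, hst2 K C.hK ▸ I.v2, ?_, ?_, ?_⟩
        · rw [proj_st_H hl, proj_st_H hl, e2, hx]; exact hd
        · intro p hp q hq hpq
          rw [hb2 p q hq]; exact I.b1 p hp q hq hpq
        · intro p hp q hq hpq
          rw [h3 p q (by grind [C.disj])]; exact I.b2 p hp q hq hpq
        · have := I.lk
          rw [e1] at this
          rw [hst2 K C.hK, hb2 _ K C.hK, h3 K r (by grind), hx]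
          exact this
      · cases e
  · cases l with
    | snd s r a =>
      obtain ⟨_, ht, h1, h2, h3⟩ := hs
      simp only [actor] at hp hl
      rw [C.m1 s hl hp] at ht
      obtain ⟨_, hr, hr'⟩ := wf_snd C.wf1 hl ht
      have hst2 : ∀ p ∈ S2.roles, c'.st p = c.st p := fun p hp => h1 p (by grind [C.disj])
      have hb2 : ∀ p ∈ S2.roles, ∀ q, c'.buf p q = c.buf p q :=
        fun p hp q => h3 p q (by grind [C.disj])
      have hb2' : ∀ p, ∀ q ∈ S2.roles, c'.buf p q = c.buf p q :=
        fun p q hp => h3 p q (by grind [C.disj])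
      have hp2 : proj S2 K c' = proj S2 K c :=
        proj_eq (fun p hp _ => hst2 p hp) (by rw [hst2 K C.hK]) (fun p hp q _ => hb2 p hp q)
      have hstH : c'.st H = c.st H := h1 H (Ne.symm hp)
      refine ⟨I.r1.snoc (l := .snd s r a) (proj_snd hl hr ?_ h1 h2 h3), hp2 ▸ I.r2,
        hstH ▸ I.v1, hst2 K C.hK ▸ I.v2, ?_, ?_, ?_⟩
      · rw [proj_st_ne hl hp, proj_st_ne hl hp]; exact ht
      · intro p hp q hq hpq
        rw [hb2' p q hq]; exact I.b1 p hp q hq hpq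
      · intro p hp q hq hpq
        rw [hb2 p hp]; exact I.b2 p hp q hq hpq
      · rw [hst2 K C.hK, hb2 K C.hK, hb2' H K C.hK, hstH]; exact I.lk
    | rcv s r a =>
      obtain ⟨_, ht, h1, h2, h3⟩ := hs
      simp only [actor] at hp hl
      rw [C.m1 r hl hp] at ht
      obtain ⟨_, hr, hr'⟩ := wf_rcv C.wf1 hl ht
      have hst2 : ∀ p ∈ S2.roles, c'.st p = c.st p := fun p hp => h1 p (by grind [C.disj])
      have hb2 : ∀ p ∈ S2.roles, ∀ q, c'.buf p q = c.buf p q :=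
        fun p hp q => h3 p q (by grind [C.disj])
      have hb2' : ∀ p, ∀ q ∈ S2.roles, c'.buf p q = c.buf p q :=
        fun p q hp => h3 p q (by grind [C.disj])
      have hp2 : proj S2 K c' = proj S2 K c :=
        proj_eq (fun p hp _ => hst2 p hp) (by rw [hst2 K C.hK]) (fun p hp q _ => hb2 p hp q)
      have hstH : c'.st H = c.st H := h1 H (Ne.symm hp)
      refine ⟨I.r1.snoc (l := .rcv s r a) (proj_rcv hr hl ?_ h1 h2 h3), hp2 ▸ I.r2,
        hstH ▸ I.v1, hst2 K C.hK ▸ I.v2, ?_, ?_, ?_⟩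
      · rw [proj_st_ne hl hp, proj_st_ne hl hp]; exact ht
      · intro p hp q hq hpq
        rw [hb2' p q hq]; exact I.b1 p hp q hq hpq
      · intro p hp q hq hpq
        rw [hb2 p hp]; exact I.b2 p hp q hq hpq
      · rw [hst2 K C.hK, hb2 K C.hK, hb2' H K C.hK, hstH]; exact I.lk

theorem Inv.step {S1 S2 S : CS R A B} {H K : R} {c c' : Config R A B} {l : Act R A}
    (C : Ctx S1 S2 H K S) (I : Inv S1 S2 H K c) (hs : Step S c l c') : Inv S1 S2 H K c' := by
  have : actor l ∈ S.roles := by cases l <;> exact hs.1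
  rcases (C.roles _).1 this with h | h
  · exact I.stepL C h hs
  · exact (I.symm.stepL C.symm h hs).symm

theorem init_proj {S1 S2 S : CS R A B} {H K : R} {c : Config R A B}
    (C : Ctx S1 S2 H K S) (h : InitConf S c) :
    c.st H = (S1.mach H).init ∧ InitConf S1 (proj S1 H c) := by
  have hr : ∀ p ∈ S1.roles, p ∈ S.roles := fun p hp => (C.roles p).2 (Or.inl hp)
  have h0 : c.st H = (S1.mach H).init := by
    rw [h.1 H (hr H C.hH), C.mH]; rfl
  refine ⟨h0, fun p hp => ?_, fun p hp q hq => ?_⟩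
  · by_cases e : p = H
    · subst e
      rw [proj_st_H hp, h0]
      obtain ⟨b, hb⟩ := C.hf1.1
      rw [hb]; rfl
    · rw [proj_st_ne hp e, h.1 p (hr p hp), C.m1 p hp e]
  · rw [proj_buf hp hq]; exact h.2 p (hr p hp) q (hr q hq)

theorem Inv.init {S1 S2 S : CS R A B} {H K : R} {c : Config R A B}
    (C : Ctx S1 S2 H K S) (h : InitConf S c) : Inv S1 S2 H K c := by
  obtain ⟨a1, a2⟩ := init_proj C h
  obtain ⟨b1, b2⟩ := init_proj C.symm h
  have hr1 : ∀ p ∈ S1.roles, p ∈ S.roles := fun p hp => (C.roles p).2 (Or.inl hp)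
  have hr2 : ∀ p ∈ S2.roles, p ∈ S.roles := fun p hp => (C.roles p).2 (Or.inr hp)
  refine ⟨⟨_, a2, .refl⟩, ⟨_, b2, .refl⟩, Or.inl (a1 ▸ C.hf1.1), Or.inl (b1 ▸ C.hf2.1),
    fun p hp q hq _ => h.2 p (hr1 p hp) q (hr2 q hq),
    fun p hp q hq _ => h.2 p (hr2 p hp) q (hr1 q hq), ?_⟩
  rw [h.2 H (hr1 H C.hH) K (hr2 K C.hK), h.2 K (hr2 K C.hK) H (hr1 H C.hH), a1, b1]
  obtain ⟨b, hb⟩ := C.hf1.1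
  obtain ⟨b', hb'⟩ := C.hf2.1
  have := C.du
  rw [hb, hb'] at this ⊢
  exact Or.inl ⟨rfl, _, this, rfl⟩

theorem Inv.of_reach {S1 S2 S : CS R A B} {H K : R} {c : Config R A B}
    (C : Ctx S1 S2 H K S) (h : Reach S c) : Inv S1 S2 H K c := by
  obtain ⟨c0, h0, h1⟩ := h
  induction h1 with
  | refl => exact Inv.init C h0
  | tail _ hs ih => obtain ⟨l, hs⟩ := hs; exact ih.step C hs

theorem gw_snd_in {M : CFSM R A B} {H K : R} {q s a q'} (h : (q, Act.snd H s a, q') ∈ M.delta) :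
    (q, Act.rcv K H a, St.hat q (Act.snd H s a) q') ∈ (M.gw H K).delta :=
  Or.inl ⟨_, _, _, _, h, Or.inl rfl⟩

theorem gw_snd_out {M : CFSM R A B} {H K : R} {q s a q'} (h : (q, Act.snd H s a, q') ∈ M.delta) :
    (St.hat q (Act.snd H s a) q', Act.snd H s a, q') ∈ (M.gw H K).delta :=
  Or.inl ⟨_, _, _, _, h, Or.inr rfl⟩

theorem gw_rcv_in {M : CFSM R A B} {H K : R} {q s a q'} (h : (q, Act.rcv s H a, q') ∈ M.delta) :
    (q, Act.rcv s H a, St.hat q (Act.rcv s H a) q') ∈ (M.gw H K).delta :=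
  Or.inr ⟨_, _, _, _, h, Or.inl rfl⟩

theorem gw_rcv_out {M : CFSM R A B} {H K : R} {q s a q'} (h : (q, Act.rcv s H a, q') ∈ M.delta) :
    (St.hat q (Act.rcv s H a) q', Act.snd H K a, q') ∈ (M.gw H K).delta :=
  Or.inr ⟨_, _, _, _, h, Or.inr rfl⟩

/-- a valid hat state has an outgoing send -/
theorem VSt.cases {S1 S2 S : CS R A B} {H K : R} {x : St R A B} (C : Ctx S1 S2 H K S)
    (h : VSt (S1.mach H) x) :
    (∃ b, x = St.base b) ∨ ∃ s r a y, (x, Act.snd s r a, y) ∈ (S.mach H).delta := by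
  rw [C.mH]
  rcases h with h | ⟨q, l, q', h, rfl⟩
  · exact Or.inl h
  · right
    cases l with
    | snd s r a =>
      obtain ⟨rfl, _⟩ := wf_snd C.wf1 C.hH h
      exact ⟨_, _, _, _, gw_snd_out h⟩
    | rcv s r a =>
      obtain ⟨rfl, _⟩ := wf_rcv C.wf1 C.hH h
      exact ⟨_, _, _, _, gw_rcv_out h⟩

/-- a receiving gateway is in a base state that is sending or receiving. -/
theorem gw_receiving {S1 S2 S : CS R A B} {H K : R} {x : St R A B} (C : Ctx S1 S2 H K S)
    (h : VSt (S1.mach H) x) (hr : (S.mach H).Receiving x) :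
    ifc x = x ∧ pj x = x ∧ ((∃ s a q', (x, Act.snd H s a, q') ∈ (S1.mach H).delta) ∨
      (S1.mach H).Receiving x) := by
  rcases h.cases C with ⟨b, rfl⟩ | ⟨s, r, a, y, hy⟩
  · refine ⟨rfl, rfl, ?_⟩
    obtain ⟨⟨l, q', ht⟩, -⟩ := hr
    rw [C.mH] at ht
    rcases gw_cases ht with ⟨s', a', q', hd, e, hx⟩ | ⟨_, _, _, _, _, e⟩ | ⟨s', a', q', hd, e, hx⟩ |
        ⟨_, _, _, _, _, e⟩
    · exact Or.inl ⟨_, _, _, hd⟩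
    · cases e
    · refine Or.inr ⟨⟨_, _, hd⟩, fun l q2 h2 => ?_⟩
      cases l with
      | snd => exact (not_mixed C.nm1 h2 hd).elim
      | rcv => trivial
    · cases e
  · exact (hr.2 _ _ hy).elim

theorem gw_final {S1 S2 S : CS R A B} {H K : R} {x : St R A B} (C : Ctx S1 S2 H K S)
    (h : VSt (S1.mach H) x) (hr : (S.mach H).Final x) :
    ifc x = x ∧ pj x = x ∧ (S1.mach H).Final x := by
  rcases h.cases C with ⟨b, rfl⟩ | ⟨s, r, a, y, hy⟩
  · refine ⟨rfl, rfl, fun l q' ht => ?_⟩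
    rw [C.mH] at hr
    cases l with
    | snd s r a =>
      obtain ⟨rfl, _⟩ := wf_snd C.wf1 C.hH ht
      exact hr _ _ (gw_snd_in ht)
    | rcv s r a =>
      obtain ⟨rfl, _⟩ := wf_rcv C.wf1 C.hH ht
      exact hr _ _ (gw_rcv_in ht)
  · exact (hr _ _ hy).elim

theorem dead_proj {S1 S2 S : CS R A B} {H K : R} {c : Config R A B} (C : Ctx S1 S2 H K S)
    (hd : DeadlockConf S c) (h : (S1.mach H).Receiving (c.st H)) (hp : pj (c.st H) = c.st H) :
    DeadlockConf S1 (proj S1 H c) := by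
  have hr1 : ∀ p ∈ S1.roles, p ∈ S.roles := fun p hp => (C.roles p).2 (Or.inl hp)
  refine ⟨fun p hp q hq => ?_, fun p hp' => ?_⟩
  · rw [proj_buf hp hq]; exact hd.1 p (hr1 p hp) q (hr1 q hq)
  · by_cases e : p = H
    · subst e; rw [proj_st_H hp', hp]; exact h
    · rw [proj_st_ne hp' e, ← C.m1 p hp' e]; exact hd.2 p (hr1 p hp')

theorem no_dead {S1 S2 S : CS R A B} {H K : R} {c : Config R A B} (C : Ctx S1 S2 H K S)
    (I : Inv S1 S2 H K c) (s1 : Safe S1) (s2 : Safe S2) : ¬ DeadlockConf S c := by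
  intro hd
  have hHr : H ∈ S.roles := (C.roles H).2 (Or.inl C.hH)
  have hKr : K ∈ S.roles := (C.roles K).2 (Or.inr C.hK)
  obtain ⟨e1, p1, x1⟩ := gw_receiving C I.v1 (hd.2 H hHr)
  obtain ⟨e2, p2, x2⟩ := gw_receiving C.symm I.v2 (hd.2 K hKr)
  have hl := I.lk
  rw [hd.1 H hHr K hKr, hd.1 K hKr H hHr, e1, e2] at hl
  have hdu : DualSt (S1.mach H) (S2.mach K) (c.st H) (c.st K) := by
    rcases hl with ⟨_, q, h1, h2⟩ | ⟨_, q, h1, h2⟩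
    · cases h2; exact h1
    · cases h2; exact h1.symm
  rcases x1 with ⟨s, a, q', ht⟩ | x1
  · rcases x2 with ⟨s', a', q'', ht'⟩ | x2
    · obtain ⟨_, _, _, h, _⟩ := hdu.snd C.d1 C.d2 ht
      exact not_mixed C.nm2 ht' h
    · exact (s2 _ I.r2).1 (dead_proj C.symm hd x2 p2)
  · exact (s1 _ I.r1).1 (dead_proj C hd x1 p1)

theorem orphan_proj {S1 S2 S : CS R A B} {H K : R} {c : Config R A B} (C : Ctx S1 S2 H K S)
    (I : Inv S1 S2 H K c) (s1 : Safe S1)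
    (hf : ∀ p ∈ S.roles, (S.mach p).Final (c.st p)) : ∀ p ∈ S1.roles, ∀ q, q ∈ S.roles →
      c.buf p q = [] := by
  have hr1 : ∀ p ∈ S1.roles, p ∈ S.roles := fun p hp => (C.roles p).2 (Or.inl hp)
  obtain ⟨e1, p1, x1⟩ := gw_final C I.v1 (hf H (hr1 H C.hH))
  obtain ⟨e2, p2, x2⟩ := gw_final C.symm I.v2 (hf K ((C.roles K).2 (Or.inr C.hK)))
  intro p hp q hq
  by_contra hne
  rcases (C.roles q).1 hq with hq | hq
  · refine (s1 _ I.r1).2.1 ⟨fun p' hp' => ?_, p, hp, q, hq, ?_⟩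
    · by_cases e : p' = H
      · subst e; rw [proj_st_H hp', p1]; exact x1
      · rw [proj_st_ne hp' e, ← C.m1 p' hp' e]; exact hf p' (hr1 p' hp')
    · rw [proj_buf hp hq]; exact hne
  · by_cases e : p = H ∧ q = K
    · obtain ⟨rfl, rfl⟩ := e
      have hl := I.lk.symm
      obtain ⟨a, w, hw⟩ := List.exists_cons_of_ne_nil hne
      rw [hw, e2] at hl
      obtain ⟨_, _, _, h, _⟩ := hl.head C.d2 C.d1
      exact x2 _ _ h
    · exact hne (I.b1 p hp q hq e)

theorem no_unspec {S1 S2 S : CS R A B} {H K : R} {c : Config R A B} (C : Ctx S1 S2 H K S)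
    (I : Inv S1 S2 H K c) (s1 : Safe S1) {r : R} (hr : r ∈ S1.roles)
    (h : (S.mach r).Receiving (c.st r))
    (hb : ∀ s a q', (c.st r, Act.rcv s r a, q') ∈ (S.mach r).delta →
      c.buf s r ≠ [] ∧ ∀ w, c.buf s r ≠ a :: w) : False := by
  by_cases e : r = H
  · subst e
    obtain ⟨e1, p1, ⟨s, a, q', ht⟩ | x1⟩ := gw_receiving C I.v1 h
    · rw [C.mH] at hb
      obtain ⟨b, w, hw⟩ := List.exists_cons_of_ne_nil (hb _ _ _ (gw_snd_in ht)).1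
      have hl := I.lk
      rw [hw, e1] at hl
      obtain ⟨s', r', q1, h1, _⟩ := hl.head C.d1 C.d2
      obtain ⟨rfl, _⟩ := wf_snd C.wf1 hr h1
      exact (hb _ _ _ (gw_snd_in h1)).2 w hw
    · refine (s1 _ I.r1).2.2 ⟨r, hr, ?_, ?_⟩
      · rw [proj_st_H hr, p1]; exact x1
      · intro s a q' ht
        rw [proj_st_H hr, p1] at ht
        rw [proj_buf (wf_rcv C.wf1 hr ht).2.1 hr]
        rw [C.mH] at hb
        exact hb _ _ _ (gw_rcv_in ht)
  · refine (s1 _ I.r1).2.2 ⟨r, hr, ?_, ?_⟩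
    · rw [proj_st_ne hr e, ← C.m1 r hr e]; exact h
    · intro s a q' ht
      rw [proj_st_ne hr e] at ht
      rw [proj_buf (wf_rcv C.wf1 hr ht).2.1 hr]
      exact hb _ _ _ (C.m1 r hr e ▸ ht)

end Helpers
end GTIR

/-- preservation of safety under composition. -/
theorem stmt12_safety_preserved
    {R A B : Type} [Finite R] [Finite A]
    (S1 S2 : CS R A B) (H K : R)
    (hH : H ∈ S1.roles) (hK : K ∈ S2.roles)
    (hdisj : S1.roles ∩ S2.roles = ∅)
    (hcompat : (S1.mach H).Compat (S2.mach K))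
    (hwf1 : S1.WF) (hwf2 : S2.WF)
    (hfin1 : S1.FiniteSys) (hfin2 : S2.FiniteSys)
    (hhf1 : (S1.mach H).HatFree) (hhf2 : (S2.mach K).HatFree)
    (hsafe1 : Safe S1) (hsafe2 : Safe S2) :
    Safe (CS.compose S1 S2 H K) := by
  have hHK : H ≠ K := fun e => by
    have : H ∈ S1.roles ∩ S2.roles := ⟨hH, e ▸ hK⟩
    rw [hdisj] at this; exact this
  have hdj : ∀ p, p ∈ S1.roles → p ∈ S2.roles → False := fun p h1 h2 => by
    have : p ∈ S1.roles ∩ S2.roles := ⟨h1, h2⟩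
    rw [hdisj] at this; exact this
  obtain ⟨hL, nm1, nm2, d1, d2⟩ := hcompat
  have C : Ctx S1 S2 H K (CS.compose S1 S2 H K) := by
    refine ⟨hH, hK, hdj, fun p => Iff.rfl, ?_, ?_, ?_, ?_, hwf1, hwf2, hhf1, hhf2, nm1, nm2,
      d1, d2, ?_⟩
    · simp [CS.compose]
    · simp [CS.compose, Ne.symm hHK]
    · intro p hp hne
      have : p ≠ K := fun e => hdj p hp (e ▸ hK)
      simp [CS.compose, hne, this, hp]
    · intro p hp hne
      have : p ≠ H := fun e => hdj p (e ▸ hH) hp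
      have h3 : p ∉ S1.roles := fun h => hdj p h hp
      simp [CS.compose, hne, this, h3]
    · intro w
      have h1 : w ∈ (S1.mach H).langNoC ↔ w ∈ dualWord '' (S2.mach K).langNoC := by rw [hL]
      refine h1.trans ⟨?_, ?_⟩
      · rintro ⟨v, hv, rfl⟩
        rw [dualWord_dualWord]; exact hv
      · intro h
        exact ⟨dualWord w, h, dualWord_dualWord w⟩
  intro c hc
  have I := Inv.of_reach C hc
  refine ⟨no_dead C I hsafe1 hsafe2, ?_, ?_⟩
  · rintro ⟨hf, p, hp, q, hq, hne⟩
    rcases (C.roles p).1 hp with h | h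
    · exact hne (orphan_proj C I hsafe1 hf p h q hq)
    · exact hne (orphan_proj C.symm I.symm hsafe2 hf p h q hq)
  · rintro ⟨r, hr, h, hb⟩
    rcases (C.roles r).1 hr with h' | h'
    · exact no_unspec C I hsafe1 h' h hb
    · exact no_unspec C.symm I.symm hsafe2 h' h hb
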